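/- arXiv:1010.3680 — 2 statements merged into one kernel-verified Lean document; each statement's English description precedes it below -/
import Mathlib

section
/- Let k > 0 be real and n ∈ ℕ. The function g(x) = G_n^{(k)}(cos(πx)) satisfies (1/2)·g''(x) + k·π·cot(πx)·g'(x) = −(π²/2)·n·(n+2k)·g(x) for every x ∈ (0,1). -/
open Real

/-- The Gegenbauer polynomial `G_n^{(k)}` as a function of a real variable. -/
noncomputable def gegenbauer (k : ℝ) (n : ℕ) (y : ℝ) : ℝ :=
  (1 / Real.Gamma k) *
    ∑ m ∈ Finset.range (n / 2 + 1),
      (-1 : ℝ) ^ m * Real.Gamma (k + n - m) /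
          ((m.factorial : ℝ) * ((n - 2 * m).factorial : ℝ)) * (2 * y) ^ (n - 2 * m)

/-- The coefficient of `(2 * y) ^ (n - 2 * m)` in `Real.Gamma k * gegenbauer k n y`. -/
noncomputable def gegenbauerCoeff (k : ℝ) (n m : ℕ) : ℝ :=
  (-1 : ℝ) ^ m * Real.Gamma (k + n - m) / ((m.factorial : ℝ) * ((n - 2 * m).factorial : ℝ))

/-- The first derivative of `gegenbauer k n`, computed termwise. -/
noncomputable def gegenbauerDeriv (k : ℝ) (n : ℕ) (y : ℝ) : ℝ :=
  (1 / Real.Gamma k) * ∑ m ∈ Finset.range (n / 2 + 1),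
    gegenbauerCoeff k n m * (((n - 2 * m : ℕ) : ℝ) * (2 * y) ^ (n - 2 * m - 1) * 2)

/-- The second derivative of `gegenbauer k n`, computed termwise. -/
noncomputable def gegenbauerDeriv₂ (k : ℝ) (n : ℕ) (y : ℝ) : ℝ :=
  (1 / Real.Gamma k) * ∑ m ∈ Finset.range (n / 2 + 1),
    gegenbauerCoeff k n m * (((n - 2 * m : ℕ) : ℝ) *
      (((n - 2 * m - 1 : ℕ) : ℝ) * (2 * y) ^ (n - 2 * m - 1 - 1) * 2) * 2)

lemma hasDerivAt_two_mul_pow (e : ℕ) (y : ℝ) :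
    HasDerivAt (fun y : ℝ => (2 * y) ^ e) ((e : ℝ) * (2 * y) ^ (e - 1) * 2) y := by
  simpa using ((hasDerivAt_id y).const_mul 2).fun_pow e

lemma hasDerivAt_gegenbauer (k : ℝ) (n : ℕ) (y : ℝ) :
    HasDerivAt (gegenbauer k n) (gegenbauerDeriv k n y) y :=
  (HasDerivAt.fun_sum fun m _ =>
    (hasDerivAt_two_mul_pow (n - 2 * m) y).const_mul (gegenbauerCoeff k n m)).const_mul _

lemma hasDerivAt_gegenbauerDeriv (k : ℝ) (n : ℕ) (y : ℝ) :
    HasDerivAt (gegenbauerDeriv k n) (gegenbauerDeriv₂ k n y) y :=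
  (HasDerivAt.fun_sum fun m _ =>
    (((hasDerivAt_two_mul_pow (n - 2 * m - 1) y).const_mul ((n - 2 * m : ℕ) : ℝ)).mul_const
      2).const_mul (gegenbauerCoeff k n m)).const_mul _

lemma gegenbauerCoeff_succ {k : ℝ} (hk : 0 < k) {n m : ℕ} (hm : 2 * (m + 1) ≤ n) :
    ((m : ℝ) + 1) * (k + n - (m + 1)) * gegenbauerCoeff k n (m + 1) =
      -(((n - 2 * m : ℕ) : ℝ) * ((n - 2 * m - 1 : ℕ) : ℝ) * gegenbauerCoeff k n m) := by
  obtain ⟨e, rfl⟩ := Nat.exists_eq_add_of_le hm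
  have h1 : 2 * (m + 1) + e - 2 * m = e + 2 := by omega
  have h2 : 2 * (m + 1) + e - 2 * (m + 1) = e := by omega
  have hpos : 0 < k + m + e + 1 := by positivity
  have hG : Real.Gamma (k + m + e + 1 + 1) = (k + m + e + 1) * Real.Gamma (k + m + e + 1) :=
    Real.Gamma_add_one hpos.ne'
  have h3 : k + ((2 * (m + 1) + e : ℕ) : ℝ) - m = k + m + e + 1 + 1 := by push_cast; ring
  have h4 : k + ((2 * (m + 1) + e : ℕ) : ℝ) - ((m + 1 : ℕ) : ℝ) = k + m + e + 1 := by
    push_cast; ring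
  have h5 : k + ((2 * (m + 1) + e : ℕ) : ℝ) - ((m : ℝ) + 1) = k + m + e + 1 := by
    push_cast; ring
  rw [gegenbauerCoeff, gegenbauerCoeff, h1, h2, h3, h4, h5, hG, Nat.add_sub_assoc (by norm_num),
    Nat.factorial_succ, Nat.factorial_succ, Nat.factorial_succ]
  have := Nat.cast_ne_zero (R := ℝ).mpr m.factorial_ne_zero
  have := Nat.cast_ne_zero (R := ℝ).mpr e.factorial_ne_zero
  push_cast
  field_simp
  ring

/-- The Gegenbauer differential equation. -/
lemma gegenbauer_differential_equation {k : ℝ} (hk : 0 < k) (n : ℕ) (y : ℝ) :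
    (1 - y ^ 2) * gegenbauerDeriv₂ k n y - (2 * k + 1) * y * gegenbauerDeriv k n y
      + n * (n + 2 * k) * gegenbauer k n y = 0 := by
  set A : ℕ → ℝ := fun m => 4 * (((n - 2 * m : ℕ) : ℝ) * ((n - 2 * m - 1 : ℕ) : ℝ) *
    gegenbauerCoeff k n m) * (2 * y) ^ (n - 2 * m - 2) with hA
  set B : ℕ → ℝ := fun m => 4 * (m * (k + n - m) * gegenbauerCoeff k n m) *
    (2 * y) ^ (n - 2 * m) with hB
  have hterm : (1 - y ^ 2) * gegenbauerDeriv₂ k n y - (2 * k + 1) * y * gegenbauerDeriv k n y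
      + n * (n + 2 * k) * gegenbauer k n y =
      (1 / Real.Gamma k) * ∑ m ∈ Finset.range (n / 2 + 1), (A m + B m) := by
    have hdef : gegenbauer k n y = (1 / Real.Gamma k) * ∑ m ∈ Finset.range (n / 2 + 1),
      gegenbauerCoeff k n m * (2 * y) ^ (n - 2 * m) := rfl
    rw [hdef, gegenbauerDeriv, gegenbauerDeriv₂, mul_left_comm, mul_left_comm _ (1 / Real.Gamma k),
      mul_left_comm _ (1 / Real.Gamma k), ← mul_sub, ← mul_add, Finset.mul_sum, Finset.mul_sum,
      Finset.mul_sum, ← Finset.sum_sub_distrib, ← Finset.sum_add_distrib]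
    congr 1
    refine Finset.sum_congr rfl fun m hm => ?_
    have hm' : 2 * m ≤ n := by have := Finset.mem_range.mp hm; omega
    obtain ⟨e, rfl⟩ := Nat.exists_eq_add_of_le hm'
    simp only [hA, hB, Nat.add_sub_cancel_left]
    rcases e with _ | _ | e
    · push_cast; simp; ring
    · push_cast; simp; ring
    · simp only [Nat.add_sub_cancel]
      push_cast
      ring
  have hA0 : A (n / 2) = 0 := by
    have : n - 2 * (n / 2) = 0 ∨ n - 2 * (n / 2) - 1 = 0 := by omega
    rcases this with h | h <;> simp [hA, h]
  have hB0 : B 0 = 0 := by simp [hB]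
  rw [hterm, Finset.sum_add_distrib, Finset.sum_range_succ, Finset.sum_range_succ' B, hA0, hB0,
    add_zero, add_zero, ← Finset.sum_add_distrib, Finset.sum_eq_zero, mul_zero]
  intro m hm
  have hm' : 2 * (m + 1) ≤ n := by have := Finset.mem_range.mp hm; omega
  have h := gegenbauerCoeff_succ hk hm'
  have he : n - 2 * (m + 1) = n - 2 * m - 2 := by omega
  simp only [hA, hB, he]
  push_cast
  rw [h]
  ring

theorem gegenbauer_cos_eigenfunction (k : ℝ) (hk : 0 < k) (n : ℕ)
    (x : ℝ) (hx : x ∈ Set.Ioo (0 : ℝ) 1) :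
    (1 / 2) * deriv (deriv (fun t : ℝ => gegenbauer k n (Real.cos (Real.pi * t)))) x
        + k * Real.pi * Real.cot (Real.pi * x) *
            deriv (fun t : ℝ => gegenbauer k n (Real.cos (Real.pi * t))) x
      = -(Real.pi ^ 2 / 2) * n * (n + 2 * k) * gegenbauer k n (Real.cos (Real.pi * x)) := by
  have hcos : ∀ t : ℝ, HasDerivAt (fun t : ℝ => Real.cos (Real.pi * t))
      (-Real.sin (Real.pi * t) * Real.pi) t := fun t => by
    simpa using ((hasDerivAt_id t).const_mul Real.pi).cos
  have hsin : HasDerivAt (fun t : ℝ => -Real.sin (Real.pi * t) * Real.pi)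
      (-(Real.cos (Real.pi * x) * Real.pi) * Real.pi) x := by
    simpa using (((hasDerivAt_id x).const_mul Real.pi).sin.neg).mul_const Real.pi
  have hderiv : deriv (fun t : ℝ => gegenbauer k n (Real.cos (Real.pi * t))) = fun t =>
      gegenbauerDeriv k n (Real.cos (Real.pi * t)) * (-Real.sin (Real.pi * t) * Real.pi) :=
    funext fun t => ((hasDerivAt_gegenbauer k n _).comp t (hcos t)).deriv
  have hderiv₂ := (((hasDerivAt_gegenbauerDeriv k n _).comp x (hcos x)).fun_mul hsin).deriv
  have hne : Real.sin (Real.pi * x) ≠ 0 :=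
    (Real.sin_pos_of_pos_of_lt_pi (mul_pos Real.pi_pos hx.1)
      (by nlinarith [Real.pi_pos, hx.2])).ne'
  have hode := gegenbauer_differential_equation hk n (Real.cos (Real.pi * x))
  rw [← Real.sin_sq] at hode
  have hcot : Real.cot (Real.pi * x) * Real.sin (Real.pi * x) = Real.cos (Real.pi * x) := by
    rw [Real.cot_eq_cos_div_sin, div_mul_cancel₀ _ hne]
  rw [hderiv]
  erw [hderiv₂]
  simp only [Function.comp_apply]
  linear_combination (Real.pi ^ 2 / 2) * hode -
    k * Real.pi ^ 2 * gegenbauerDeriv k n (Real.cos (Real.pi * x)) * hcot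
end

section
/- Let k ≥ 1/2 be real, t > 0 and x ∈ (0,1). Define the radial affine Dunkl transition density q_t(x,y) = ∑_{n=0}^∞ e^{−λ_n t}·G_n^{(k)}(cos(πx))·G_n^{(k)}(cos(πy))·ω_n^{(k)}·(sin(πy))^{2k} for y ∈ (0,1). Then the function y ↦ (sin(πy))^{−2}·q_t(x,y) is integrable on (0,1) if and only if k > 1/2. -/
open Real MeasureTheory

/-- The eigenvalue `λ_n = (π²/2) n (n + 2k)`. -/
noncomputable def lambdaAff (k : ℝ) (n : ℕ) : ℝ :=
  Real.pi ^ 2 / 2 * n * (n + 2 * k)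

/-- The normalization constant `ω_n^{(k)}`. -/
noncomputable def omegaAff (k : ℝ) (n : ℕ) : ℝ :=
  (n.factorial : ℝ) * (k + n) * Real.Gamma k ^ 2 /
    ((2 : ℝ) ^ (1 - 2 * k) * Real.Gamma (n + 2 * k))

/-- The transition density of the radial affine Dunkl process. -/
noncomputable def qDensity (k t x y : ℝ) : ℝ :=
  ∑' n : ℕ,
    Real.exp (-(lambdaAff k n) * t) * gegenbauer k n (Real.cos (Real.pi * x)) *
      gegenbauer k n (Real.cos (Real.pi * y)) * omegaAff k n *
        Real.sin (Real.pi * y) ^ (2 * k)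


/-- A sequence of functions solving a triangular pure-death system, with `M 0 = 1` and
nonnegative initial values. -/
structure DeathChain (M : ℕ → ℝ → ℝ) : Prop where
  hasDerivAt : ∀ N s, HasDerivAt (M (N + 1)) ((N + 1) * (N + 2) * (M N s - M (N + 1) s)) s
  zero_eq : ∀ s, M 0 s = 1
  nonneg_zero : ∀ N, 0 ≤ M N 0

namespace DeathChain

variable {M : ℕ → ℝ → ℝ}

lemma lower_bound (h : DeathChain M) {N : ℕ} {A σ : ℝ} (hA : ∀ u, σ ≤ u → A ≤ M N u)
    (hσ : 0 ≤ M (N + 1) σ) {s : ℝ} (hs : σ ≤ s) :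
    A * (1 - exp (-((N + 1) * (N + 2) * (s - σ)))) ≤ M (N + 1) s := by
  set a : ℝ := (N + 1) * (N + 2) with ha
  have ha0 : 0 ≤ a := by positivity
  have hd : ∀ u, HasDerivAt (fun u => exp (a * u) * (M (N + 1) u - A))
      (a * exp (a * u) * (M N u - A)) u := by
    intro u
    have h1 : HasDerivAt (fun u => exp (a * u)) (exp (a * u) * (a * 1)) u :=
      ((hasDerivAt_id u).const_mul a).exp
    have h2 := h1.mul ((h.hasDerivAt N u).sub_const A)
    refine h2.congr_deriv ?_
    rw [← ha]
    ring
  have hmono : MonotoneOn (fun u => exp (a * u) * (M (N + 1) u - A)) (Set.Ici σ) := by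
    refine monotoneOn_of_deriv_nonneg (convex_Ici σ)
      (fun u _ => (hd u).continuousAt.continuousWithinAt)
      (fun u _ => (hd u).differentiableAt.differentiableWithinAt) ?_
    intro u hu
    rw [(hd u).deriv]
    rw [interior_Ici] at hu
    have := hA u hu.le
    have : 0 ≤ M N u - A := by linarith
    positivity
  have h1 := hmono (Set.self_mem_Ici) (Set.mem_Ici.2 hs) hs
  simp only at h1
  have h2 : exp (-(a * (s - σ))) * exp (a * s) = exp (a * σ) := by
    rw [← Real.exp_add]; ring_nf
  have h3 : 0 < exp (a * s) := exp_pos _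
  have h4 : 0 ≤ exp (a * σ) * M (N + 1) σ := by positivity
  have h5 : (A * (1 - exp (-(a * (s - σ))))) * exp (a * s) ≤ M (N + 1) s * exp (a * s) := by
    have : (A * (1 - exp (-(a * (s - σ))))) * exp (a * s)
      = A * exp (a * s) - A * (exp (-(a * (s - σ))) * exp (a * s)) := by ring
    rw [this, h2]
    linarith
  exact le_of_mul_le_mul_right h5 h3

lemma nonneg (h : DeathChain M) (N : ℕ) : ∀ s, 0 ≤ s → 0 ≤ M N s := by
  induction N with
  | zero => intro s _; rw [h.zero_eq]; exact zero_le_one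
  | succ N ih =>
    intro s hs
    simpa using h.lower_bound ih (h.nonneg_zero (N + 1)) hs

lemma exists_pos_le (h : DeathChain M) (N : ℕ) :
    ∀ σ, 0 < σ → ∃ A, 0 < A ∧ ∀ s, σ ≤ s → A ≤ M N s := by
  induction N with
  | zero => exact fun σ _ => ⟨1, one_pos, fun s _ => (h.zero_eq s).ge⟩
  | succ N ih =>
    intro σ hσ
    obtain ⟨A, hA, hAM⟩ := ih (σ / 2) (by positivity)
    refine ⟨A * (1 - exp (-((N + 1) * (N + 2) * (σ / 2)))), ?_, ?_⟩
    · have : exp (-((N + 1) * (N + 2) * (σ / 2))) < 1 := by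
        rw [Real.exp_lt_one_iff]
        have : 0 < ((N : ℝ) + 1) * (N + 2) * (σ / 2) := by positivity
        linarith
      exact mul_pos hA (by linarith)
    · intro s hs
      refine le_trans ?_ (h.lower_bound hAM (h.nonneg _ _ (by positivity)) (by linarith : σ / 2 ≤ s))
      gcongr
      linarith

lemma summable_log_div :
    Summable fun N : ℕ => 2 * log (N + 2) / (((N : ℝ) + 1) * (N + 2)) := by
  have h : Summable fun N : ℕ => 8 * (1 / ((N + 1 : ℕ) : ℝ) ^ (3 / 2 : ℝ)) :=
    ((summable_nat_add_iff 1).2 (Real.summable_one_div_nat_rpow.2 (by norm_num))).mul_left 8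
  refine Summable.of_nonneg_of_le (fun N => ?_) (fun N => ?_) h
  · have : 0 ≤ log ((N : ℝ) + 2) := log_nonneg (by linarith [N.cast_nonneg (α := ℝ)])
    positivity
  · have hN : (0 : ℝ) ≤ N := N.cast_nonneg
    have h1 := Real.log_le_rpow_div (x := (N : ℝ) + 2) (by positivity) (ε := 1 / 2) (by norm_num)
    have h2 : ((N : ℝ) + 2) = ((N : ℝ) + 2) ^ (1 / 2 : ℝ) * ((N : ℝ) + 2) ^ (1 / 2 : ℝ) := by
      rw [← Real.rpow_add (by positivity)]; norm_num
    have h3 : ((N : ℝ) + 1) ^ (3 / 2 : ℝ) = (N + 1) * (N + 1) ^ (1 / 2 : ℝ) := by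
      rw [← Real.rpow_one_add' (by positivity) (by norm_num)]; norm_num
    have h4 : ((N : ℝ) + 1) ^ (1 / 2 : ℝ) ≤ ((N : ℝ) + 2) ^ (1 / 2 : ℝ) := by gcongr; norm_num
    push_cast
    rw [h3, mul_one_div, div_le_div_iff₀ (by positivity) (by positivity)]
    set p := ((N : ℝ) + 2) ^ (1 / 2 : ℝ)
    set q := ((N : ℝ) + 1) ^ (1 / 2 : ℝ)
    have hq : 0 < q := by positivity
    have hp : 0 < p := by positivity
    calc 2 * log (N + 2) * ((N + 1) * q) ≤ 2 * (p / (1 / 2)) * ((N + 1) * p) := by gcongr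
      _ = 4 * ((N + 1) * (p * p)) := by ring
      _ = 4 * ((N + 1) * (N + 2)) := by rw [← h2]
      _ ≤ 8 * ((N + 1) * (N + 2)) := by gcongr; norm_num

lemma exists_uniform_lower_bound (h : DeathChain M) {s : ℝ} (hs : 0 < s) :
    ∃ c, 0 < c ∧ ∀ᶠ N in Filter.atTop, c ≤ M N s := by
  set ε : ℕ → ℝ := fun N => 2 * log (N + 2) / (((N : ℝ) + 1) * (N + 2)) with hε
  have hε0 : ∀ N, 0 ≤ ε N := fun N => by
    have : 0 ≤ log ((N : ℝ) + 2) := log_nonneg (by linarith [N.cast_nonneg (α := ℝ)])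
    simp only [hε]; positivity
  have hsum : Summable ε := summable_log_div
  obtain ⟨N₀, hN₀⟩ : ∃ N₀ : ℕ, ∑' j, ε (j + N₀) < s / 2 :=
    (((tendsto_sum_nat_add ε).eventually (gt_mem_nhds (by positivity : 0 < s / 2)))).exists
  obtain ⟨A, hA, hAM⟩ := h.exists_pos_le N₀ (s / 2) (by positivity)
  have key : ∀ j : ℕ, ∀ u, s / 2 + ∑ i ∈ Finset.range j, ε (i + N₀) ≤ u →
      A / 2 * (((j + N₀ : ℕ) + 2 : ℝ) / ((j + N₀ : ℕ) + 1)) ≤ M (j + N₀) u := by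
    intro j
    induction j with
    | zero =>
      intro u hu
      simp only [Finset.range_zero, Finset.sum_empty, add_zero] at hu
      rw [zero_add]
      refine le_trans ?_ (hAM u hu)
      have : ((N₀ : ℝ) + 2) / (N₀ + 1) ≤ 2 := by
        rw [div_le_iff₀ (by positivity)]; linarith [N₀.cast_nonneg (α := ℝ)]
      nlinarith
    | succ j ih =>
      intro u hu
      rw [Finset.sum_range_succ] at hu
      have hS : 0 ≤ ∑ i ∈ Finset.range j, ε (i + N₀) := Finset.sum_nonneg fun i _ => hε0 _
      have hεj := hε0 (j + N₀)
      have h1 := h.lower_bound ih (h.nonneg _ _ (by positivity))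
        (by linarith : s / 2 + ∑ i ∈ Finset.range j, ε (i + N₀) ≤ u)
      rw [show j + 1 + N₀ = j + N₀ + 1 by ring]
      refine le_trans ?_ h1
      set n := j + N₀
      have hn : (0 : ℝ) ≤ n := n.cast_nonneg
      have h2 : exp (-(((n : ℝ) + 1) * (n + 2) * (u - (s / 2 + ∑ i ∈ Finset.range j, ε (i + N₀)))))
          ≤ 1 / ((n : ℝ) + 2) ^ 2 := by
        have h3 : ((n : ℝ) + 1) * (n + 2) * ε n = 2 * log (n + 2) := by
          simp only [hε]; field_simp
        calc _ ≤ exp (-(2 * log (n + 2))) := by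
              rw [← h3]
              gcongr
              linarith
          _ = 1 / ((n : ℝ) + 2) ^ 2 := by
              rw [Real.exp_neg, two_mul, Real.exp_add, Real.exp_log (by positivity)]
              field_simp
      calc A / 2 * (((n + 1 : ℕ) + 2 : ℝ) / ((n + 1 : ℕ) + 1))
          = A / 2 * (((n : ℝ) + 2) / (n + 1)) * (1 - 1 / ((n : ℝ) + 2) ^ 2) := by
            push_cast
            field_simp
            ring
        _ ≤ _ := by gcongr
  refine ⟨A / 2, by positivity, ?_⟩
  filter_upwards [Filter.eventually_ge_atTop N₀] with N hN
  obtain ⟨j, rfl⟩ := Nat.exists_eq_add_of_le' hN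
  have hle : ∑ i ∈ Finset.range j, ε (i + N₀) ≤ ∑' j, ε (j + N₀) :=
    ((summable_nat_add_iff N₀).2 hsum).sum_le_tsum _ (fun i _ => hε0 _)
  refine le_trans ?_ (key j s (by linarith))
  refine le_mul_of_one_le_right (by positivity) ?_
  rw [one_le_div (by positivity)]
  linarith

end DeathChain

/-- The expansion coefficients of `(N + 1) ((1 + z) / 2) ^ N` in the basis `(2 n + 1) P_n(z)`. -/
noncomputable def legendreMomentCoeff (N : ℕ) : ℕ → ℝ
  | 0 => 1
  | n + 1 => legendreMomentCoeff N n * (((N : ℝ) - n) / (N + n + 2))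

namespace legendreMomentCoeff

lemma abs_le_one (N n : ℕ) : |legendreMomentCoeff N n| ≤ 1 := by
  induction n with
  | zero => simp [legendreMomentCoeff]
  | succ n ih =>
    rw [legendreMomentCoeff, abs_mul]
    refine mul_le_one₀ ih (abs_nonneg _) ?_
    have hN : (0 : ℝ) ≤ N := N.cast_nonneg
    have hn : (0 : ℝ) ≤ n := n.cast_nonneg
    rw [abs_div, abs_of_pos (by positivity : (0 : ℝ) < N + n + 2), div_le_one (by positivity),
      abs_le]
    constructor <;> linarith

lemma eq_zero_of_lt {N n : ℕ} (h : N < n) : legendreMomentCoeff N n = 0 := by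
  induction n with
  | zero => omega
  | succ n ih =>
    rw [legendreMomentCoeff]
    rcases Nat.lt_succ_iff_lt_or_eq.1 h with h | rfl
    · rw [ih h, zero_mul]
    · simp

lemma tendsto_one (n : ℕ) :
    Filter.Tendsto (fun N => legendreMomentCoeff N n) Filter.atTop (nhds 1) := by
  induction n with
  | zero => simp [legendreMomentCoeff]
  | succ n ih =>
    simp only [legendreMomentCoeff]
    have h1 : Filter.Tendsto (fun N : ℕ => 1 - (2 * n + 2 : ℝ) / ((N : ℝ) + (n + 2)))
        Filter.atTop (nhds (1 - 0)) := by
      refine tendsto_const_nhds.sub (Filter.Tendsto.div_atTop tendsto_const_nhds ?_)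
      exact Filter.tendsto_atTop_add_const_right _ _ tendsto_natCast_atTop_atTop
    have h2 : (fun N : ℕ => ((N : ℝ) - n) / (N + n + 2))
        = fun N : ℕ => 1 - (2 * n + 2 : ℝ) / ((N : ℝ) + (n + 2)) := by
      funext N
      have : (N : ℝ) + (n + 2) ≠ 0 := by positivity
      have : (N : ℝ) + n + 2 ≠ 0 := by positivity
      field_simp
      ring
    rw [← h2] at h1
    simpa using ih.mul h1

lemma succ_left (N n : ℕ) : ((N : ℝ) + 1 - n) * (N + n + 2) * legendreMomentCoeff (N + 1) n
    = (N + 1) * (N + 2) * legendreMomentCoeff N n := by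
  induction n with
  | zero => simp [legendreMomentCoeff]
  | succ n ih =>
    simp only [legendreMomentCoeff]
    push_cast
    have h1 : (N : ℝ) + n + 2 ≠ 0 := by positivity
    have h2 : (N : ℝ) + 1 + n + 2 ≠ 0 := by positivity
    have h3 : legendreMomentCoeff N n * ((N + 1) * (N + 2))
      = ((N : ℝ) + 1 - n) * (N + n + 2) * legendreMomentCoeff (N + 1) n := by rw [ih]; ring
    field_simp
    linear_combination (-(N - n : ℝ) * (N + n + 3)) * h3

lemma succ_succ (N n : ℕ) : legendreMomentCoeff (N + 1) (n + 1)
    = (N + 1) * (N + 2) / ((N + n + 2) * (N + n + 3)) * legendreMomentCoeff N n := by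
  have h := succ_left N n
  have h1 : (N : ℝ) + n + 2 ≠ 0 := by positivity
  have h2 : (N : ℝ) + 1 + n + 2 ≠ 0 := by positivity
  have h3 : (N : ℝ) + n + 3 ≠ 0 := by positivity
  simp only [legendreMomentCoeff]
  push_cast
  field_simp
  linear_combination (N + n + 3 : ℝ) * h

end legendreMomentCoeff

section LegendreRecurrence

variable {P : ℕ → ℝ} {z : ℝ}

lemma sum_legendreMoment_diff (h0 : P 0 = 1) (h1 : P 1 = z)
    (hP : ∀ n : ℕ, ((n : ℝ) + 2) * P (n + 2) = (2 * n + 3) * z * P (n + 1) - (n + 1) * P n)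
    (N R : ℕ) :
    ∑ n ∈ Finset.range (R + 1), ((N + 1) * ((2 * n + 1) * legendreMomentCoeff (N + 1) n * P n)
      - (N + 2) * ((1 + z) / 2) * ((2 * n + 1) * legendreMomentCoeff N n * P n))
    = -((N + 2) / 2) * (R + 1) * (legendreMomentCoeff N R * P (R + 1)
      - legendreMomentCoeff N (R + 1) * P R) := by
  induction R with
  | zero =>
    have : (N : ℝ) + 2 ≠ 0 := by positivity
    simp [legendreMomentCoeff, h0, h1]
    field_simp
    ring
  | succ R ih =>
    rw [Finset.sum_range_succ, ih, legendreMomentCoeff.succ_succ]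
    simp only [legendreMomentCoeff]
    push_cast
    have e1 : (N : ℝ) + R + 2 ≠ 0 := by positivity
    have e2 : (N : ℝ) + R + 3 ≠ 0 := by positivity
    have e3 : (N : ℝ) + (R + 1) + 2 ≠ 0 := by positivity
    have hR : z * P (R + 1) * (2 * R + 3) = (R + 2) * P (R + 2) + (R + 1) * P R := by
      rw [hP R]; ring
    have hR' : (N + 2) * ((1 + z) / 2) * ((2 * ((R : ℝ) + 1) + 1) *
        (legendreMomentCoeff N R * ((N - R) / (N + R + 2))) * P (R + 1))
      = (N + 2) / 2 * (legendreMomentCoeff N R * ((N - R) / (N + R + 2))) *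
        ((2 * R + 3) * P (R + 1) + ((R + 2) * P (R + 2) + (R + 1) * P R)) := by
      rw [← hR]; ring
    rw [hR']
    field_simp
    ring

lemma sum_legendreMoment (h0 : P 0 = 1) (h1 : P 1 = z)
    (hP : ∀ n : ℕ, ((n : ℝ) + 2) * P (n + 2) = (2 * n + 3) * z * P (n + 1) - (n + 1) * P n)
    (N : ℕ) :
    ∑ n ∈ Finset.range (N + 1), (2 * n + 1) * legendreMomentCoeff N n * P n
      = (N + 1) * ((1 + z) / 2) ^ N := by
  induction N with
  | zero => simp [legendreMomentCoeff, h0]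
  | succ N ih =>
    have h := sum_legendreMoment_diff h0 h1 hP N (N + 1)
    rw [legendreMomentCoeff.eq_zero_of_lt (by omega : N < N + 1),
      legendreMomentCoeff.eq_zero_of_lt (by omega : N < N + 1 + 1), Finset.sum_sub_distrib,
      ← Finset.mul_sum, ← Finset.mul_sum, Finset.sum_range_succ _ (N + 1),
      Finset.sum_range_succ (fun n : ℕ => (2 * (n : ℝ) + 1) * legendreMomentCoeff N n * P n) (N + 1),
      ih, legendreMomentCoeff.eq_zero_of_lt (by omega : N < N + 1),
      ← Finset.sum_range_succ (fun n : ℕ => (2 * (n : ℝ) + 1) * legendreMomentCoeff (N + 1) n * P n)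
        (N + 1)] at h
    have hN : (N : ℝ) + 1 ≠ 0 := by positivity
    apply mul_left_cancel₀ hN
    push_cast
    linear_combination h

lemma deathChain_legendreMoment (h0 : P 0 = 1) (h1 : P 1 = z)
    (hP : ∀ n : ℕ, ((n : ℝ) + 2) * P (n + 2) = (2 * n + 3) * z * P (n + 1) - (n + 1) * P n)
    (hz : -1 ≤ z) :
    DeathChain fun N s => ∑ n ∈ Finset.range (N + 1),
      (2 * n + 1) * legendreMomentCoeff N n * P n * exp (-(n * (n + 1) * s)) where
  hasDerivAt N s := by
    have hd : ∀ n : ℕ, HasDerivAt (fun s : ℝ => exp (-((n : ℝ) * (n + 1) * s)))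
        (exp (-((n : ℝ) * (n + 1) * s)) * -((n : ℝ) * (n + 1) * 1)) s := fun n =>
      (((hasDerivAt_id s).const_mul ((n : ℝ) * (n + 1))).neg).exp
    have := HasDerivAt.fun_sum (u := Finset.range (N + 1 + 1)) fun (n : ℕ) _ =>
      (hd n).const_mul ((2 * (n : ℝ) + 1) * legendreMomentCoeff (N + 1) n * P n)
    refine this.congr_deriv ?_
    have hN : ∑ n ∈ Finset.range (N + 1),
        (2 * (n : ℝ) + 1) * legendreMomentCoeff N n * P n * exp (-(n * (n + 1) * s))
        = ∑ n ∈ Finset.range (N + 1 + 1),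
        (2 * (n : ℝ) + 1) * legendreMomentCoeff N n * P n * exp (-(n * (n + 1) * s)) := by
      rw [Finset.sum_range_succ _ (N + 1), legendreMomentCoeff.eq_zero_of_lt (by omega : N < N + 1)]
      simp
    rw [hN, ← Finset.sum_sub_distrib, Finset.mul_sum]
    refine Finset.sum_congr rfl fun n _ => ?_
    have := legendreMomentCoeff.succ_left N n
    linear_combination ((2 * (n : ℝ) + 1) * P n * exp (-(n * (n + 1) * s))) * this
  zero_eq s := by simp [legendreMomentCoeff, h0]
  nonneg_zero N := by
    have := sum_legendreMoment h0 h1 hP N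
    simp only [mul_zero, neg_zero, exp_zero, mul_one]
    rw [this]
    have : 0 ≤ (1 + z) / 2 := by linarith
    positivity

lemma tsum_legendre_heat_pos (h0 : P 0 = 1) (h1 : P 1 = z)
    (hP : ∀ n : ℕ, ((n : ℝ) + 2) * P (n + 2) = (2 * n + 3) * z * P (n + 1) - (n + 1) * P n)
    (hz : -1 ≤ z) {s : ℝ} (hs : 0 < s)
    (hsum : Summable fun n : ℕ => (2 * n + 1) * |P n| * exp (-(n * (n + 1) * s))) :
    0 < ∑' n : ℕ, (2 * n + 1) * P n * exp (-(n * (n + 1) * s)) := by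
  obtain ⟨c, hc, hcM⟩ := (deathChain_legendreMoment h0 h1 hP hz).exists_uniform_lower_bound hs
  have hlim : Filter.Tendsto (fun N : ℕ => ∑' n : ℕ,
      (2 * (n : ℝ) + 1) * legendreMomentCoeff N n * P n * exp (-(n * (n + 1) * s))) Filter.atTop
      (nhds (∑' n : ℕ, (2 * n + 1) * P n * exp (-(n * (n + 1) * s)))) := by
    refine tendsto_tsum_of_dominated_convergence hsum ?_ ?_
    · intro n
      have := (((legendreMomentCoeff.tendsto_one n).const_mul (2 * (n : ℝ) + 1)).mul_const
        (P n)).mul_const (exp (-(n * (n + 1) * s)))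
      simpa using this
    · refine Filter.Eventually.of_forall fun N n => ?_
      have h2 : (0 : ℝ) ≤ 2 * n + 1 := by positivity
      rw [Real.norm_eq_abs, abs_mul, abs_mul, abs_mul, abs_of_nonneg h2, abs_of_pos (exp_pos _)]
      gcongr
      exact mul_le_of_le_one_right h2 (legendreMomentCoeff.abs_le_one N n)
  refine lt_of_lt_of_le hc (ge_of_tendsto hlim ?_)
  filter_upwards [hcM] with N hN
  rw [tsum_eq_sum (s := Finset.range (N + 1))]
  · exact hN
  · intro n hn
    rw [legendreMomentCoeff.eq_zero_of_lt (by simpa using hn)]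
    simp

end LegendreRecurrence

/-- The `m`-th term of the sum defining the Gegenbauer polynomial, extended by zero. -/
noncomputable def gegenbauerTerm (k : ℝ) (n m : ℕ) (y : ℝ) : ℝ :=
  if 2 * m ≤ n then
    (-1 : ℝ) ^ m * Real.Gamma (k + n - m) /
      ((m.factorial : ℝ) * ((n - 2 * m).factorial : ℝ)) * (2 * y) ^ (n - 2 * m)
  else 0

lemma gegenbauer_eq_sum_term (k : ℝ) (n : ℕ) (y : ℝ) {R : ℕ} (hR : n / 2 + 1 ≤ R) :
    gegenbauer k n y = 1 / Real.Gamma k * ∑ m ∈ Finset.range R, gegenbauerTerm k n m y := by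
  rw [gegenbauer, ← Finset.sum_subset (Finset.range_mono hR) (fun m _ hm => ?_)]
  · congr 1
    refine Finset.sum_congr rfl fun m hm => ?_
    rw [Finset.mem_range] at hm
    rw [gegenbauerTerm, if_pos (by omega)]
  · rw [Finset.mem_range] at hm
    rw [gegenbauerTerm, if_neg (by omega)]

lemma gegenbauerTerm_zero_recurrence {k : ℝ} (hk : 0 < k) (n : ℕ) (y : ℝ) :
    ((n : ℝ) + 2) * gegenbauerTerm k (n + 2) 0 y
      = 2 * (n + 1 + k) * y * gegenbauerTerm k (n + 1) 0 y := by
  have hΓ : Real.Gamma (k + n + 2) = (k + n + 1) * Real.Gamma (k + n + 1) := by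
    rw [← Real.Gamma_add_one (by positivity)]; ring_nf
  simp only [gegenbauerTerm, mul_zero, Nat.zero_le, if_true, pow_zero, Nat.sub_zero, Nat.cast_zero,
    sub_zero, Nat.factorial_zero, Nat.cast_one, one_mul]
  push_cast [Nat.factorial_succ]
  rw [show k + ((n : ℝ) + 2) = k + n + 2 by ring, show k + ((n : ℝ) + 1) = k + n + 1 by ring, hΓ]
  have h1 : (n : ℝ) + 1 ≠ 0 := by positivity
  have h2 : (n : ℝ) + 1 + 1 ≠ 0 := by positivity
  have h3 : (n.factorial : ℝ) ≠ 0 := by positivity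
  field_simp
  ring

lemma gegenbauerTerm_succ_recurrence {k : ℝ} (hk : 0 < k) (n m : ℕ) (y : ℝ) :
    ((n : ℝ) + 2) * gegenbauerTerm k (n + 2) (m + 1) y
      = 2 * (n + 1 + k) * y * gegenbauerTerm k (n + 1) (m + 1) y
        - (n + 2 * k) * gegenbauerTerm k n m y := by
  rcases lt_trichotomy n (2 * m) with h | rfl | h
  · simp only [gegenbauerTerm]
    rw [if_neg (by omega), if_neg (by omega), if_neg (by omega)]
    simp
  · simp only [gegenbauerTerm]
    rw [if_pos (by omega), if_neg (by omega), if_pos (by omega)]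
    have hΓ : Real.Gamma (k + m + 1) = (k + m) * Real.Gamma (k + m) :=
      Real.Gamma_add_one (by positivity)
    rw [show 2 * m + 2 - 2 * (m + 1) = 0 by omega, Nat.sub_self]
    push_cast [Nat.factorial_succ]
    rw [show k + (2 * (m : ℝ) + 2) - (m + 1) = k + m + 1 by ring,
      show k + (2 * (m : ℝ)) - m = k + m by ring, hΓ]
    have h1 : (m : ℝ) + 1 ≠ 0 := by positivity
    have h3 : (m.factorial : ℝ) ≠ 0 := by positivity
    field_simp
    ring
  · obtain ⟨j, rfl⟩ := Nat.exists_eq_add_of_lt h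
    simp only [gegenbauerTerm]
    rw [if_pos (by omega), if_pos (by omega), if_pos (by omega)]
    rw [show 2 * m + j + 1 + 2 - 2 * (m + 1) = j + 1 by omega,
      show 2 * m + j + 1 + 1 - 2 * (m + 1) = j by omega,
      show 2 * m + j + 1 - 2 * m = j + 1 by omega]
    push_cast [Nat.factorial_succ]
    have hΓ : Real.Gamma (k + m + j + 1 + 1) = (k + m + j + 1) * Real.Gamma (k + m + j + 1) :=
      Real.Gamma_add_one (by positivity)
    rw [show k + (2 * (m : ℝ) + j + 1 + 2) - (m + 1) = k + m + j + 1 + 1 by ring,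
      show k + (2 * (m : ℝ) + j + 1 + 1) - (m + 1) = k + m + j + 1 by ring,
      show k + (2 * (m : ℝ) + j + 1) - m = k + m + j + 1 by ring, hΓ]
    have h1 : (m : ℝ) + 1 ≠ 0 := by positivity
    have h2 : (j : ℝ) + 1 ≠ 0 := by positivity
    have h3 : (m.factorial : ℝ) ≠ 0 := by positivity
    have h4 : (j.factorial : ℝ) ≠ 0 := by positivity
    field_simp
    ring

lemma gegenbauer_recurrence {k : ℝ} (hk : 0 < k) (n : ℕ) (y : ℝ) :
    ((n : ℝ) + 2) * gegenbauer k (n + 2) y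
      = 2 * (n + 1 + k) * y * gegenbauer k (n + 1) y - (n + 2 * k) * gegenbauer k n y := by
  rw [gegenbauer_eq_sum_term k (n + 2) y (R := n + 2 + 1) (by omega),
    gegenbauer_eq_sum_term k (n + 1) y (R := n + 2 + 1) (by omega),
    gegenbauer_eq_sum_term k n y (R := n + 2) (by omega)]
  have h : ((n : ℝ) + 2) * ∑ m ∈ Finset.range (n + 2 + 1), gegenbauerTerm k (n + 2) m y
      = 2 * (n + 1 + k) * y * ∑ m ∈ Finset.range (n + 2 + 1), gegenbauerTerm k (n + 1) m y
        - (n + 2 * k) * ∑ m ∈ Finset.range (n + 2), gegenbauerTerm k n m y := by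
    rw [Finset.sum_range_succ', Finset.sum_range_succ' _ (n + 2), mul_add, mul_add,
      gegenbauerTerm_zero_recurrence hk, Finset.mul_sum, Finset.mul_sum, Finset.mul_sum,
      Finset.sum_congr rfl fun m _ => gegenbauerTerm_succ_recurrence hk n m y,
      Finset.sum_sub_distrib]
    ring
  linear_combination (1 / Real.Gamma k) * h

lemma gegenbauer_zero {k : ℝ} (hk : 0 < k) (y : ℝ) : gegenbauer k 0 y = 1 := by
  have := (Real.Gamma_pos_of_pos hk).ne'
  simp [gegenbauer, this]

lemma gegenbauer_one {k : ℝ} (hk : 0 < k) (y : ℝ) : gegenbauer k 1 y = 2 * k * y := by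
  have := (Real.Gamma_pos_of_pos hk).ne'
  simp [gegenbauer, Real.Gamma_add_one hk.ne']
  field_simp

lemma continuous_gegenbauer (k : ℝ) (n : ℕ) : Continuous (gegenbauer k n) := by
  unfold gegenbauer
  fun_prop

lemma abs_gegenbauer_le {k : ℝ} (hk : 0 < k) {y : ℝ} (hy : |y| ≤ 1) (n : ℕ) :
    |gegenbauer k n y| ≤ (3 + 4 * k) ^ n := by
  induction n using Nat.strong_induction_on with
  | _ n ih =>
    match n with
    | 0 => simp [gegenbauer_zero hk]
    | 1 =>
      rw [gegenbauer_one hk, abs_mul, abs_of_pos (by positivity), pow_one]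
      nlinarith
    | n + 2 =>
      have h0 := ih n (by omega)
      have h1 := ih (n + 1) (by omega)
      have hC : (3 + 4 * k) ^ n ≤ (3 + 4 * k) ^ (n + 1) :=
        pow_le_pow_right₀ (by linarith) (by omega)
      have hn : (0 : ℝ) ≤ n := n.cast_nonneg
      have key : ((n : ℝ) + 2) * |gegenbauer k (n + 2) y| ≤
          (n + 2) * ((3 + 4 * k) ^ (n + 2)) := by
        calc ((n : ℝ) + 2) * |gegenbauer k (n + 2) y|
            = |2 * (n + 1 + k) * y * gegenbauer k (n + 1) y - (n + 2 * k) * gegenbauer k n y| := by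
              rw [← gegenbauer_recurrence hk, abs_mul,
                abs_of_pos (by positivity : 0 < (n : ℝ) + 2)]
          _ ≤ |2 * (n + 1 + k) * y * gegenbauer k (n + 1) y| + |(n + 2 * k) * gegenbauer k n y| :=
              abs_sub _ _
          _ = 2 * (n + 1 + k) * |y| * |gegenbauer k (n + 1) y|
              + (n + 2 * k) * |gegenbauer k n y| := by
              rw [abs_mul, abs_mul, abs_mul (_ + _),
                abs_of_pos (by positivity : 0 < 2 * ((n : ℝ) + 1 + k)),
                abs_of_pos (by positivity : 0 < (n : ℝ) + 2 * k)]
          _ ≤ 2 * (n + 1 + k) * 1 * (3 + 4 * k) ^ (n + 1)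
              + (n + 2 * k) * (3 + 4 * k) ^ (n + 1) := by
              gcongr
              exact h0.trans hC
          _ = (3 * n + 2 + 4 * k) * (3 + 4 * k) ^ (n + 1) := by ring
          _ ≤ ((n + 2) * (3 + 4 * k)) * (3 + 4 * k) ^ (n + 1) := by
              gcongr
              nlinarith
          _ = (n + 2) * ((3 + 4 * k) ^ (n + 2)) := by ring
      exact le_of_mul_le_mul_left key (by positivity)

lemma gegenbauer_half_recurrence (n : ℕ) (y : ℝ) :
    ((n : ℝ) + 2) * gegenbauer (1 / 2) (n + 2) y
      = (2 * n + 3) * y * gegenbauer (1 / 2) (n + 1) y - (n + 1) * gegenbauer (1 / 2) n y := by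
  rw [gegenbauer_recurrence (by norm_num)]
  ring

lemma gegenbauer_half_one (n : ℕ) : gegenbauer (1 / 2) n 1 = 1 := by
  induction n using Nat.strong_induction_on with
  | _ n ih =>
    match n with
    | 0 => exact gegenbauer_zero (by norm_num) 1
    | 1 => rw [gegenbauer_one (by norm_num)]; norm_num
    | n + 2 =>
      have h := gegenbauer_half_recurrence n 1
      rw [ih n (by omega), ih (n + 1) (by omega)] at h
      have : (n : ℝ) + 2 ≠ 0 := by positivity
      apply mul_left_cancel₀ this
      rw [h]; ring

lemma omegaAff_pos {k : ℝ} (hk : 0 < k) (n : ℕ) : 0 < omegaAff k n := by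
  have h1 := Real.Gamma_pos_of_pos hk
  have h2 : 0 < Real.Gamma (n + 2 * k) := Real.Gamma_pos_of_pos (by positivity)
  unfold omegaAff
  positivity

lemma omegaAff_half (n : ℕ) : omegaAff (1 / 2) n = π / 2 * (2 * n + 1) := by
  have h : Real.Gamma ((n : ℝ) + 2 * (1 / 2)) = n.factorial := by
    rw [← Real.Gamma_nat_eq_factorial]; norm_num
  rw [omegaAff, h, Real.Gamma_one_half_eq, Real.sq_sqrt Real.pi_pos.le]
  have : (n.factorial : ℝ) ≠ 0 := by positivity
  norm_num
  field_simp
  ring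

lemma omegaAff_le {k : ℝ} (hk : 1 / 2 ≤ k) (n : ℕ) : omegaAff k n ≤ omegaAff k 0 * 3 ^ n := by
  induction n with
  | zero => simp
  | succ n ih =>
    have hk0 : 0 < k := by linarith
    have hn : (0 : ℝ) ≤ n := n.cast_nonneg
    have hpos := omegaAff_pos hk0 n
    have h : omegaAff k (n + 1) = omegaAff k n * (((n : ℝ) + 1) * (k + n + 1) /
        ((k + n) * (n + 2 * k))) := by
      have hΓ : Real.Gamma (((n + 1 : ℕ) : ℝ) + 2 * k)
          = (n + 2 * k) * Real.Gamma (n + 2 * k) := by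
        rw [← Real.Gamma_add_one (by positivity)]; push_cast; ring_nf
      have h2 : Real.Gamma (n + 2 * k) ≠ 0 := (Real.Gamma_pos_of_pos (by positivity)).ne'
      have h3 : (2 : ℝ) ^ (1 - 2 * k) ≠ 0 := by positivity
      have h4 : k + n ≠ 0 := by positivity
      have h5 : (n : ℝ) + 2 * k ≠ 0 := by positivity
      rw [omegaAff, omegaAff, hΓ]
      push_cast [Nat.factorial_succ]
      field_simp
      ring
    have hr : ((n : ℝ) + 1) * (k + n + 1) / ((k + n) * (n + 2 * k)) ≤ 3 := by
      rw [div_le_iff₀ (by positivity)]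
      have : ((n : ℝ) + 1) * (k + n + 1) ≤ (n + 2 * k) * (3 * (k + n)) := by
        gcongr <;> linarith
      linarith
    calc omegaAff k (n + 1) ≤ omegaAff k n * 3 := by rw [h]; gcongr
      _ ≤ omegaAff k 0 * 3 ^ n * 3 := by gcongr
      _ = omegaAff k 0 * 3 ^ (n + 1) := by ring

lemma summable_exp_neg_mul_sq_mul_pow {c D : ℝ} (hc : 0 < c) (hD : 0 < D) :
    Summable fun n : ℕ => exp (-(c * (n : ℝ) ^ 2)) * D ^ n := by
  set L := Real.log D + 1 with hL
  refine Summable.of_nonneg_of_le (fun n => by positivity) (fun n => ?_)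
    ((Real.summable_exp_neg_nat).mul_left (exp (L ^ 2 / (4 * c))))
  rw [← Real.exp_log hD, ← Real.exp_nat_mul, ← Real.exp_add, ← Real.exp_add]
  apply Real.exp_le_exp.2
  have : L ^ 2 / (4 * c) - (L * n - c * (n : ℝ) ^ 2) = (L - 2 * c * n) ^ 2 / (4 * c) := by
    field_simp; ring
  have h2 : 0 ≤ (L - 2 * c * n) ^ 2 / (4 * c) := by positivity
  have h3 : (n : ℝ) * Real.log D = L * n - n := by rw [hL]; ring
  linarith

/-- The spherical series appearing in `qDensity`, without the factor `sin (π y) ^ (2 k)`. -/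
noncomputable def heatSeries (k t x y : ℝ) : ℝ :=
  ∑' n : ℕ,
    Real.exp (-(lambdaAff k n) * t) * gegenbauer k n (Real.cos (Real.pi * x)) *
      gegenbauer k n (Real.cos (Real.pi * y)) * omegaAff k n

lemma qDensity_eq (k t x y : ℝ) :
    qDensity k t x y = heatSeries k t x y * Real.sin (Real.pi * y) ^ (2 * k) := by
  rw [qDensity, heatSeries, tsum_mul_right]

/-- A summable majorant of `heatSeries`, uniform in the space variables. -/
noncomputable def heatBound (k t : ℝ) (n : ℕ) : ℝ :=
  omegaAff k 0 * (exp (-(π ^ 2 / 2 * t * (n : ℝ) ^ 2)) * (3 * (3 + 4 * k) ^ 2) ^ n)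

lemma summable_heatBound {k t : ℝ} (hk : 0 < k) (ht : 0 < t) : Summable (heatBound k t) :=
  (summable_exp_neg_mul_sq_mul_pow (by positivity) (by positivity)).mul_left _

lemma norm_heatSeries_term_le {k t : ℝ} (hk : 1 / 2 ≤ k) (ht : 0 < t) (x y : ℝ) (n : ℕ) :
    ‖exp (-(lambdaAff k n) * t) * gegenbauer k n (cos (π * x)) *
      gegenbauer k n (cos (π * y)) * omegaAff k n‖ ≤ heatBound k t n := by
  have hk0 : 0 < k := by linarith
  have hω := omegaAff_pos hk0 n
  have hl : -(lambdaAff k n) * t ≤ -(π ^ 2 / 2 * t * (n : ℝ) ^ 2) := by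
    have : 0 ≤ π ^ 2 / 2 * n * (2 * k) * t := by positivity
    rw [lambdaAff]
    linarith
  rw [Real.norm_eq_abs, abs_mul, abs_mul, abs_mul, abs_of_pos (exp_pos _), abs_of_pos hω]
  calc _ ≤ exp (-(π ^ 2 / 2 * t * (n : ℝ) ^ 2)) * (3 + 4 * k) ^ n * (3 + 4 * k) ^ n
        * (omegaAff k 0 * 3 ^ n) := by
        gcongr
        · exact abs_gegenbauer_le hk0 (abs_cos_le_one _) n
        · exact abs_gegenbauer_le hk0 (abs_cos_le_one _) n
        · exact omegaAff_le hk n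
    _ = heatBound k t n := by rw [heatBound, mul_pow, ← pow_mul, mul_comm 2 n, pow_mul]; ring

lemma continuous_heatSeries {k t : ℝ} (hk : 1 / 2 ≤ k) (ht : 0 < t) (x : ℝ) :
    Continuous (heatSeries k t x) := by
  refine continuous_tsum (fun n => ?_) (summable_heatBound (by linarith) ht)
    (fun n y => norm_heatSeries_term_le hk ht x y n)
  have := continuous_gegenbauer k n
  fun_prop

lemma abs_heatSeries_le {k t : ℝ} (hk : 1 / 2 ≤ k) (ht : 0 < t) (x y : ℝ) :
    |heatSeries k t x y| ≤ ∑' n, heatBound k t n :=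
  tsum_of_norm_bounded (summable_heatBound (by linarith) ht).hasSum
    (norm_heatSeries_term_le hk ht x y)

lemma heatSeries_half_zero_pos {t : ℝ} (ht : 0 < t) (x : ℝ) : 0 < heatSeries (1 / 2) t x 0 := by
  set P : ℕ → ℝ := fun n => gegenbauer (1 / 2) n (cos (π * x)) with hP
  have hterm : ∀ n : ℕ, exp (-(lambdaAff (1 / 2) n) * t) * gegenbauer (1 / 2) n (cos (π * x)) *
      gegenbauer (1 / 2) n (cos (π * 0)) * omegaAff (1 / 2) n
      = π / 2 * ((2 * n + 1) * P n * exp (-(n * (n + 1) * (π ^ 2 / 2 * t)))) := by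
    intro n
    have hexp : -(lambdaAff (1 / 2) n) * t = -(n * (n + 1) * (π ^ 2 / 2 * t)) := by
      rw [lambdaAff]; ring
    rw [hexp, mul_zero, cos_zero, gegenbauer_half_one, omegaAff_half]
    ring
  rw [heatSeries, tsum_congr hterm, tsum_mul_left]
  refine mul_pos (by positivity) (tsum_legendre_heat_pos (z := cos (π * x)) ?_ ?_ ?_
    (neg_one_le_cos _) (by positivity) ?_)
  · exact gegenbauer_zero (by norm_num) _
  · simp only [hP]
    rw [gegenbauer_one (by norm_num)]
    ring
  · exact fun n => gegenbauer_half_recurrence n _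
  · refine Summable.of_nonneg_of_le (fun n => by positivity) (fun n => ?_)
      ((summable_heatBound (k := 1 / 2) (by norm_num) ht).mul_left (2 / π))
    have h := norm_heatSeries_term_le (k := 1 / 2) le_rfl ht x 0 n
    rw [hterm, Real.norm_eq_abs, abs_mul, abs_mul, abs_mul, abs_of_pos (exp_pos _),
      abs_of_pos (by positivity : 0 < π / 2),
      abs_of_pos (by positivity : (0 : ℝ) < 2 * n + 1)] at h
    calc _ = 2 / π * (π / 2 * ((2 * n + 1) * |P n| * exp (-(n * (n + 1) * (π ^ 2 / 2 * t))))) := by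
          field_simp
      _ ≤ _ := by gcongr

lemma integrableOn_sin_pi_mul_rpow {p : ℝ} (hp : -1 < p) :
    IntegrableOn (fun y : ℝ => sin (π * y) ^ p) (Set.Ioo (0 : ℝ) 1) := by
  have hmeas : AEStronglyMeasurable (fun y : ℝ => sin (π * y) ^ p)
      (volume.restrict (Set.Ioo (0 : ℝ) 1)) := by
    have : Measurable fun y : ℝ => sin (π * y) ^ p := by fun_prop
    exact this.aestronglyMeasurable
  have hsin : ∀ y ∈ Set.Ioo (0 : ℝ) 1, 0 < sin (π * y) := fun y hy =>
    sin_pos_of_pos_of_lt_pi (mul_pos pi_pos hy.1) (by nlinarith [pi_pos, hy.2])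
  rcases le_or_gt 0 p with h0 | h0
  · refine Integrable.mono' (g := fun _ => (1 : ℝ)) (by simp) hmeas ?_
    refine ae_restrict_of_forall_mem measurableSet_Ioo fun y hy => ?_
    rw [Real.norm_eq_abs, abs_of_pos (rpow_pos_of_pos (hsin y hy) p)]
    exact rpow_le_one (hsin y hy).le (sin_le_one _) h0
  · have h1 : IntegrableOn (fun y : ℝ => y ^ p) (Set.Ioo (0 : ℝ) 1) :=
      (intervalIntegral.integrableOn_Ioo_rpow_iff one_pos).2 hp
    have h2 : IntegrableOn (fun y : ℝ => (1 - y) ^ p) (Set.Ioo (0 : ℝ) 1) := by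
      have := (intervalIntegral.intervalIntegrable_rpow' hp (a := 0) (b := 1)).comp_sub_left 1
      rw [sub_zero, sub_self] at this
      exact (intervalIntegrable_iff_integrableOn_Ioo_of_le zero_le_one).1 this.symm
    have h3 : IntegrableOn (fun y : ℝ => 2 ^ p * (y ^ p + (1 - y) ^ p)) (Set.Ioo (0 : ℝ) 1) :=
      (h1.add h2).const_mul _
    refine Integrable.mono' h3 hmeas ?_
    refine ae_restrict_of_forall_mem measurableSet_Ioo fun y hy => ?_
    have hy0 : 0 < y := hy.1
    have hy1 : 0 < 1 - y := by linarith [hy.2]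
    rw [Real.norm_eq_abs, abs_of_pos (rpow_pos_of_pos (hsin y hy) p)]
    have hlow : ∀ u : ℝ, 0 < u → u ≤ 1 / 2 → sin (π * u) ^ p ≤ 2 ^ p * u ^ p := by
      intro u hu hu2
      rw [← mul_rpow (by norm_num) hu.le]
      refine rpow_le_rpow_of_nonpos (by positivity) ?_ h0.le
      have := Real.mul_le_sin (x := π * u) (by positivity) (by nlinarith [pi_pos])
      calc 2 * u = 2 / π * (π * u) := by field_simp
        _ ≤ _ := this
    have e1 : 0 < y ^ p := rpow_pos_of_pos hy0 p
    have e2 : 0 < (1 - y) ^ p := rpow_pos_of_pos hy1 p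
    have e3 : (0 : ℝ) < 2 ^ p := by positivity
    rcases le_total y (1 / 2) with h | h
    · have := hlow y hy0 h
      nlinarith [mul_pos e3 e2]
    · have := hlow (1 - y) hy1 (by linarith)
      rw [show π * (1 - y) = π - π * y by ring, sin_pi_sub] at this
      nlinarith [mul_pos e3 e1]

lemma sin_rpow_neg_two_mul_qDensity (k t x : ℝ) {y : ℝ} (hy : y ∈ Set.Ioo (0 : ℝ) 1) :
    sin (π * y) ^ (-2 : ℝ) * qDensity k t x y
      = heatSeries k t x y * sin (π * y) ^ (2 * k - 2) := by
  have hsin : 0 < sin (π * y) :=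
    sin_pos_of_pos_of_lt_pi (mul_pos pi_pos hy.1) (by nlinarith [pi_pos, hy.2])
  rw [qDensity_eq, sub_eq_add_neg, rpow_add hsin]
  ring

lemma not_integrableOn_density_half {t : ℝ} (ht : 0 < t) (x : ℝ) :
    ¬ IntegrableOn (fun y : ℝ => heatSeries (1 / 2) t x y * sin (π * y) ^ (2 * (1 / 2 : ℝ) - 2))
      (Set.Ioo (0 : ℝ) 1) := by
  intro h
  have hpos := heatSeries_half_zero_pos ht x
  set c := heatSeries (1 / 2) t x 0 with hc
  have hev : ∀ᶠ y in nhds (0 : ℝ), c / 2 < heatSeries (1 / 2) t x y :=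
    (continuous_heatSeries le_rfl ht x).continuousAt.eventually (lt_mem_nhds (by linarith))
  obtain ⟨δ, hδ, hball⟩ := Metric.eventually_nhds_iff.1 hev
  set r := min δ 1 with hr
  have hr0 : 0 < r := lt_min hδ one_pos
  have hsub : Set.Ioo (0 : ℝ) r ⊆ Set.Ioo 0 1 := Set.Ioo_subset_Ioo_right (min_le_right _ _)
  have hint : IntegrableOn (fun y : ℝ => y ^ (-1 : ℝ)) (Set.Ioo (0 : ℝ) r) := by
    refine Integrable.mono' ((h.mono_set hsub).const_mul (2 * π / c))
      (by have : Measurable fun y : ℝ => y ^ (-1 : ℝ) := by fun_prop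
          exact this.aestronglyMeasurable) ?_
    refine ae_restrict_of_forall_mem measurableSet_Ioo fun y hy => ?_
    have hy0 : 0 < y := hy.1
    have hyδ : y < δ := hy.2.trans_le (min_le_left _ _)
    have hsin : 0 < sin (π * y) :=
      sin_pos_of_pos_of_lt_pi (by positivity) (by nlinarith [pi_pos, (hsub hy).2])
    have hF : c / 2 < heatSeries (1 / 2) t x y :=
      hball (by rw [Real.dist_eq, sub_zero, abs_of_pos hy0]; exact hyδ)
    have hF0 : 0 ≤ heatSeries (1 / 2) t x y := by linarith
    have hle : sin (π * y) ≤ π * y := sin_le (by positivity)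
    rw [show 2 * (1 / 2 : ℝ) - 2 = -1 by norm_num, rpow_neg_one, rpow_neg_one, Real.norm_eq_abs,
      abs_of_pos (by positivity)]
    calc y⁻¹ = 2 * π / c * (c / 2 * (π * y)⁻¹) := by field_simp
      _ ≤ 2 * π / c * (heatSeries (1 / 2) t x y * (sin (π * y))⁻¹) := by gcongr
  exact lt_irrefl _ ((intervalIntegral.integrableOn_Ioo_rpow_iff hr0).1 hint)

theorem integrable_inv_sin_sq_density_iff (k : ℝ) (hk : 1 / 2 ≤ k)
    (t : ℝ) (ht : 0 < t) (x : ℝ) (hx : x ∈ Set.Ioo (0 : ℝ) 1) :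
    IntegrableOn
        (fun y : ℝ => Real.sin (Real.pi * y) ^ (-2 : ℝ) * qDensity k t x y)
        (Set.Ioo (0 : ℝ) 1)
      ↔ 1 / 2 < k := by
  rw [integrableOn_congr_fun (fun y hy => sin_rpow_neg_two_mul_qDensity k t x hy)
    measurableSet_Ioo]
  constructor
  · intro h
    refine lt_of_le_of_ne hk ?_
    rintro rfl
    exact not_integrableOn_density_half ht x h
  · intro h
    exact (integrableOn_sin_pi_mul_rpow (by linarith)).bdd_mul
      (continuous_heatSeries hk ht x).aestronglyMeasurable
      (Filter.Eventually.of_forall fun y => abs_heatSeries_le hk ht x y)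
end
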